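/- Bounds on the redundancy of FCCs for the Hamming weight function: for any t ≥ 5 and k > t, 10t/3 − 10/3 ≤ r_wt(k,t) ≤ 4t / (1 − 2√(ln(2t)/(2t))). -/

import Mathlib

/-- The systematic encoding `u ↦ (u, p u)` is a function-correcting code for `f`
tolerating `t` errors. -/
def IsFCC {k r : ℕ} {S : Type*} (t : ℕ) (f : (Fin k → ZMod 2) → S)
    (p : (Fin k → ZMod 2) → (Fin r → ZMod 2)) : Prop :=
  ∀ u₁ u₂ : Fin k → ZMod 2, f u₁ ≠ f u₂ →
    2 * t + 1 ≤ hammingDist u₁ u₂ + hammingDist (p u₁) (p u₂)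

/-- `r_f(k,t)`: the optimal (smallest) redundancy of an FCC for `f` tolerating `t` errors. -/
noncomputable def FCCredundancy {k : ℕ} {S : Type*} (f : (Fin k → ZMod 2) → S)
    (t : ℕ) : ℕ :=
  sInf {r : ℕ | ∃ p : (Fin k → ZMod 2) → (Fin r → ZMod 2), IsFCC t f p}

open Finset in
/-- Number of words in a Hamming ball, bounded by the Chernoff–Hoeffding method. -/
theorem card_hammingDist_lt_le {n D : ℕ} {ε : ℝ} (hε : 0 ≤ ε)
    (hD : (D : ℝ) - 1 ≤ n * (1 / 2 - ε)) (c : Fin n → ZMod 2) :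
    (#{x : Fin n → ZMod 2 | hammingDist c x < D} : ℝ) ≤
      2 ^ n * Real.exp (-(2 * n * ε ^ 2)) := by
  set q := Real.exp (-(4 * ε)) with hq
  have hsum : ∑ x : Fin n → ZMod 2, q ^ hammingDist c x = (1 + q) ^ n := by
    have hprod (x : Fin n → ZMod 2) :
        q ^ hammingDist c x = ∏ i, if c i ≠ x i then q else 1 := by
      rw [Finset.prod_ite]
      simp [hammingDist]
    have hcoord (a : ZMod 2) : (∑ z : ZMod 2, if a ≠ z then q else 1) = 1 + q := by
      have h2 : (univ : Finset (ZMod 2)) = {0, 1} := rfl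
      rw [h2]
      obtain rfl | rfl : a = 0 ∨ a = 1 := by revert a; decide
      all_goals simp [add_comm]
    simp_rw [hprod]
    rw [← Fintype.piFinset_univ,
      ← Finset.prod_univ_sum (fun _ => univ) fun i z => if c i ≠ z then q else 1]
    simp only [hcoord, Finset.prod_const, Finset.card_univ, Fintype.card_fin]
  have hcosh : 1 + q ≤ 2 * Real.exp (-(2 * ε) + 2 * ε ^ 2) := by
    have h := Real.cosh_le_exp_half_sq (2 * ε)
    rw [Real.cosh_eq] at h
    have h1 : 1 + q =
        2 * (Real.exp (-(2 * ε)) * ((Real.exp (2 * ε) + Real.exp (-(2 * ε))) / 2)) := by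
      rw [hq, show -(4 * ε) = -(2 * ε) + -(2 * ε) by ring, Real.exp_add]
      have : Real.exp (-(2 * ε)) * Real.exp (2 * ε) = 1 := by rw [← Real.exp_add]; simp
      linear_combination -this
    rw [h1, Real.exp_add, show 2 * ε ^ 2 = (2 * ε) ^ 2 / 2 by ring]
    gcongr
  have hball : (#{x : Fin n → ZMod 2 | hammingDist c x < D} : ℝ) *
      Real.exp (-(4 * ε * (n * (1 / 2 - ε)))) ≤ (1 + q) ^ n := by
    rw [← hsum, ← nsmul_eq_mul]
    refine (Finset.card_nsmul_le_sum _ (fun x => q ^ hammingDist c x) _ ?_).trans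
      (Finset.sum_le_univ_sum_of_nonneg fun x => by positivity)
    intro x hx
    rw [hq, ← Real.exp_nat_mul, Real.exp_le_exp]
    have hlt : hammingDist c x + 1 ≤ D := (Finset.mem_filter.mp hx).2
    have hlt' : (hammingDist c x : ℝ) + 1 ≤ D := by exact_mod_cast hlt
    have : (hammingDist c x : ℝ) ≤ n * (1 / 2 - ε) := by linarith
    nlinarith [mul_le_mul_of_nonneg_left this hε]
  have hpow : (1 + q) ^ n ≤ 2 ^ n * Real.exp (n * (-(2 * ε) + 2 * ε ^ 2)) := by
    rw [Real.exp_nat_mul, ← mul_pow]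
    gcongr
  have h := hball.trans hpow
  rw [Real.exp_neg, ← div_eq_mul_inv, div_le_iff₀ (Real.exp_pos _), mul_assoc,
    ← Real.exp_add] at h
  refine h.trans_eq ?_
  congr 2
  ring

/-- The Gilbert–Varshamov bound. -/
theorem exists_code_of_mul_card_ball_lt {n D M : ℕ} {V : ℝ}
    (hV : ∀ c : Fin n → ZMod 2,
      (Finset.card {x : Fin n → ZMod 2 | hammingDist c x < D} : ℝ) ≤ V)
    (hMV : M * V < 2 ^ n) :
    ∃ c : ℕ → Fin n → ZMod 2, ∀ i j, i < j → j < M → D ≤ hammingDist (c i) (c j) := by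
  have hV0 : 0 ≤ V := (Nat.cast_nonneg _).trans (hV 0)
  induction M with
  | zero => exact ⟨0, fun i j _ hj => absurd hj (Nat.not_lt_zero j)⟩
  | succ M ih =>
    push_cast at hMV
    obtain ⟨c, hc⟩ := ih (by linarith)
    obtain ⟨y, hy⟩ : ∃ y, ∀ i < M, D ≤ hammingDist (c i) y := by
      by_contra! h
      have hcover : (Finset.univ : Finset (Fin n → ZMod 2)) ⊆
          (Finset.range M).biUnion fun i => {x | hammingDist (c i) x < D} := by
        intro y _
        simpa using h y
      have hcard : (2 ^ n : ℝ) ≤ M * V := by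
        calc (2 ^ n : ℝ) = ((Finset.univ : Finset (Fin n → ZMod 2)).card : ℝ) := by
              simp [ZMod.card]
          _ ≤ ∑ i ∈ Finset.range M,
              (Finset.card {x : Fin n → ZMod 2 | hammingDist (c i) x < D} : ℝ) := by
            exact_mod_cast (Finset.card_le_card hcover).trans Finset.card_biUnion_le
          _ ≤ ∑ _i ∈ Finset.range M, V := Finset.sum_le_sum fun i _ => hV _
          _ = M * V := by simp
      linarith
    refine ⟨Function.update c M y, fun i j hij hj => ?_⟩
    rw [Function.update_of_ne (by omega : i ≠ M)]
    rcases eq_or_ne j M with rfl | hjM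
    · rw [Function.update_self]
      exact hy i hij
    · rw [Function.update_of_ne hjM]
      exact hc i j hij (by omega)

theorem four_mul_log_lt_self {x : ℝ} (hx : 10 ≤ x) : 4 * Real.log x < x := by
  have h10 : Real.log 10 < 5 / 2 := by
    rw [Real.log_lt_iff_lt_exp (by norm_num)]
    have h : Real.exp (5 / 2) ^ 2 = Real.exp 1 ^ 5 := by
      rw [← Real.exp_nat_mul, ← Real.exp_nat_mul]
      norm_num
    have he : (2.7 : ℝ) ^ 5 ≤ Real.exp 1 ^ 5 := by
      gcongr
      linarith [Real.exp_one_gt_d9]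
    refine lt_of_pow_lt_pow_left₀ 2 (Real.exp_pos _).le ?_
    rw [h]
    exact lt_of_lt_of_le (by norm_num) he
  have h : Real.log (x / 10) ≤ x / 10 - 1 := Real.log_le_sub_one_of_pos (by positivity)
  rw [Real.log_div (by positivity) (by norm_num)] at h
  linarith

/-- Short binary codes with `D + 1` words and minimum distance `D`. -/
theorem exists_code_length_le {D : ℕ} (hD : 10 ≤ D) :
    ∃ n : ℕ, (n : ℝ) ≤ 2 * D / (1 - 2 * √(Real.log D / D)) ∧
      ∃ c : ℕ → Fin n → ZMod 2, ∀ i j, i < j → j < D + 1 → D ≤ hammingDist (c i) (c j) := by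
  have hD' : (10 : ℝ) ≤ D := by exact_mod_cast hD
  have hD0 : (0 : ℝ) < D := by linarith
  have hlog : 0 < Real.log D := Real.log_pos (by linarith)
  set ε := √(Real.log D / D) with hε
  have hε0 : 0 ≤ ε := Real.sqrt_nonneg _
  have hεsq : D * ε ^ 2 = Real.log D := by
    rw [hε, Real.sq_sqrt (by positivity)]
    field_simp
  have hε1 : 0 < 1 - 2 * ε := by
    by_contra! h
    nlinarith [four_mul_log_lt_self hD', mul_nonneg hD0.le (show 0 ≤ ε ^ 2 - 1 / 4 by nlinarith)]
  set B := 2 * (D : ℝ) / (1 - 2 * ε) with hB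
  have hBmul : B * (1 - 2 * ε) = 2 * D := div_mul_cancel₀ _ hε1.ne'
  have hB0 : 0 ≤ B := by positivity
  have hfloor := Nat.lt_floor_add_one B
  refine ⟨⌊B⌋₊, Nat.floor_le hB0, ?_⟩
  have hDn : (D : ℝ) ≤ ⌊B⌋₊ := by
    have : 2 * (D : ℝ) ≤ B := by nlinarith
    linarith
  refine exists_code_of_mul_card_ball_lt
    (card_hammingDist_lt_le hε0 (by nlinarith)) ?_
  have hexp : Real.exp (-(2 * (⌊B⌋₊ : ℝ) * ε ^ 2)) ≤ ((D : ℝ) ^ 2)⁻¹ := by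
    rw [← Real.exp_log (show (0 : ℝ) < ((D : ℝ) ^ 2)⁻¹ by positivity), Real.exp_le_exp,
      Real.log_inv, Real.log_pow]
    push_cast
    nlinarith [mul_le_mul_of_nonneg_right hDn (sq_nonneg ε)]
  have hlt : ((D + 1 : ℕ) : ℝ) * ((D : ℝ) ^ 2)⁻¹ < 1 := by
    rw [← div_eq_mul_inv, div_lt_one (by positivity)]
    push_cast
    nlinarith
  calc ((D + 1 : ℕ) : ℝ) * (2 ^ ⌊B⌋₊ * Real.exp (-(2 * (⌊B⌋₊ : ℝ) * ε ^ 2)))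
      ≤ ((D + 1 : ℕ) : ℝ) * (2 ^ ⌊B⌋₊ * ((D : ℝ) ^ 2)⁻¹) := by gcongr
    _ = 2 ^ ⌊B⌋₊ * (((D + 1 : ℕ) : ℝ) * ((D : ℝ) ^ 2)⁻¹) := by ring
    _ < 2 ^ ⌊B⌋₊ * 1 := by gcongr
    _ = 2 ^ ⌊B⌋₊ := mul_one _

/-- A code with `2t + 1` words and minimum distance `2t`, indexed by the weight modulo
`2t + 1`, gives a function-correcting code for the Hamming weight. -/
theorem isFCC_hammingNorm_of_code {k n t : ℕ} {c : ℕ → Fin n → ZMod 2}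
    (hc : ∀ i j, i < j → j < 2 * t + 1 → 2 * t ≤ hammingDist (c i) (c j)) :
    IsFCC t (fun u : Fin k → ZMod 2 => hammingNorm u)
      (fun u => c (hammingNorm u % (2 * t + 1))) := by
  intro u v huv
  have hne : 0 < hammingDist u v := hammingDist_pos.mpr fun h => huv (by rw [h])
  have h1 : hammingNorm u ≤ hammingDist u v + hammingNorm v := by
    simpa using hammingDist_triangle u v 0
  have h2 : hammingNorm v ≤ hammingDist u v + hammingNorm u := by
    simpa [hammingDist_comm] using hammingDist_triangle v u 0
  have hu := Nat.mod_lt (hammingNorm u) (Nat.succ_pos (2 * t))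
  have hv := Nat.mod_lt (hammingNorm v) (Nat.succ_pos (2 * t))
  rcases lt_trichotomy (hammingNorm u % (2 * t + 1)) (hammingNorm v % (2 * t + 1)) with h | h | h
  · have := hc _ _ h hv
    dsimp only
    omega
  · rcases lt_or_gt_of_ne huv with hlt | hlt
    · have := Nat.le_of_dvd (Nat.sub_pos_of_lt hlt) ((Nat.modEq_iff_dvd' hlt.le).mp h)
      dsimp only at this
      omega
    · have := Nat.le_of_dvd (Nat.sub_pos_of_lt hlt) ((Nat.modEq_iff_dvd' hlt.le).mp h.symm)
      dsimp only at this
      omega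
  · have := hc _ _ h hu
    rw [hammingDist_comm] at this
    dsimp only
    omega

/-- Among `M` bits, at most `M² / 4` pairs differ. -/
theorem sum_pairs_ne_le (x : ℕ → ZMod 2) (M : ℕ) :
    (∑ j ∈ Finset.range M, ∑ i ∈ Finset.range j, if x i ≠ x j then (1 : ℝ) else 0) ≤
      (M : ℝ) ^ 2 / 4 := by
  set s : ℕ → ℝ := fun i => if x i = 0 then 1 else -1 with hs
  have hbit (a b : ZMod 2) : (if a ≠ b then (1 : ℝ) else 0) =
      (1 - (if a = 0 then 1 else -1) * (if b = 0 then 1 else -1)) / 2 := by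
    have h01 (a : ZMod 2) : a = 0 ∨ a = 1 := by revert a; decide
    rcases h01 a with rfl | rfl <;> rcases h01 b with rfl | rfl <;> norm_num
  have hsq (i : ℕ) : s i ^ 2 = 1 := by
    simp only [hs]
    split_ifs <;> norm_num
  have key : (∑ j ∈ Finset.range M, ∑ i ∈ Finset.range j, if x i ≠ x j then (1 : ℝ) else 0) =
      ((M : ℝ) ^ 2 - (∑ i ∈ Finset.range M, s i) ^ 2) / 4 := by
    induction M with
    | zero => simp
    | succ M ih =>
      have hrow : (∑ i ∈ Finset.range M, if x i ≠ x M then (1 : ℝ) else 0) =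
          (M - (∑ i ∈ Finset.range M, s i) * s M) / 2 := by
        simp_rw [hbit]
        rw [← Finset.sum_div, Finset.sum_sub_distrib, ← Finset.sum_mul]
        simp [hs]
      rw [Finset.sum_range_succ, ih, hrow, Finset.sum_range_succ]
      push_cast
      linear_combination (1 / 4) * hsq M
  rw [key]
  nlinarith [sq_nonneg (∑ i ∈ Finset.range M, s i)]

/-- The Plotkin averaging bound. -/
theorem sum_hammingDist_le {r : ℕ} (c : ℕ → Fin r → ZMod 2) (M : ℕ) :
    ∑ j ∈ Finset.range M, ∑ i ∈ Finset.range j, (hammingDist (c i) (c j) : ℝ) ≤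
      r * ((M : ℝ) ^ 2 / 4) := by
  have h (i j : ℕ) : (hammingDist (c i) (c j) : ℝ) =
      ∑ l, if c i l ≠ c j l then (1 : ℝ) else 0 := by
    rw [Finset.sum_boole]
    rfl
  simp_rw [h]
  calc _ = ∑ l, ∑ j ∈ Finset.range M, ∑ i ∈ Finset.range j,
          if c i l ≠ c j l then (1 : ℝ) else 0 := by
        rw [Finset.sum_comm]
        exact Finset.sum_congr rfl fun j _ => Finset.sum_comm
    _ ≤ ∑ _l : Fin r, (M : ℝ) ^ 2 / 4 :=
        Finset.sum_le_sum fun l _ => sum_pairs_ne_le (fun i => c i l) M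
    _ = _ := by simp

theorem sum_pairs_sub_dist (a : ℝ) (M : ℕ) :
    ∑ j ∈ Finset.range M, ∑ i ∈ Finset.range j, (a - ((j : ℝ) - i)) =
      a * (M * (M - 1) / 2) - (M + 1) * M * (M - 1) / 6 := by
  have hrow (M : ℕ) (b : ℝ) : ∑ i ∈ Finset.range M, (b + (i : ℝ)) =
      M * b + M * (M - 1) / 2 := by
    induction M with
    | zero => simp
    | succ M ih =>
      rw [Finset.sum_range_succ, ih]
      push_cast
      ring
  induction M with
  | zero => simp
  | succ M ih =>
    rw [Finset.sum_range_succ, ih]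
    simp_rw [← sub_add]
    rw [hrow]
    push_cast
    ring

/-- The word `1…10…0` of length `k` that starts with `i` ones. -/
def prefixWord (k i : ℕ) : Fin k → ZMod 2 := fun l => if (l : ℕ) < i then 1 else 0

theorem hammingNorm_prefixWord {k i : ℕ} (hi : i ≤ k) : hammingNorm (prefixWord k i) = i := by
  simp [hammingNorm, prefixWord, Fin.card_filter_val_lt, hi]

theorem hammingDist_prefixWord_le {k i j : ℕ} (hij : i ≤ j) :
    hammingDist (prefixWord k i) (prefixWord k j) ≤ j - i := by
  rw [← Nat.card_Ico i j, hammingDist]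
  refine Finset.card_le_card_of_injOn Fin.val ?_ Fin.val_injective.injOn
  intro l hl
  have hl : prefixWord k i l ≠ prefixWord k j l := by simpa using hl
  simp only [Finset.coe_Ico, Set.mem_Ico]
  by_contra h
  refine hl ?_
  have : (l : ℕ) < i ↔ (l : ℕ) < j := by omega
  simp only [prefixWord, this]

theorem IsFCC.le_redundancy {k r t : ℕ} (hk : t < k) {p : (Fin k → ZMod 2) → (Fin r → ZMod 2)}
    (hp : IsFCC t (fun u : Fin k → ZMod 2 => hammingNorm u) p) :
    10 * (t : ℝ) / 3 - 10 / 3 ≤ r := by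
  have hlower : ∑ j ∈ Finset.range (t + 2), ∑ i ∈ Finset.range j,
      ((2 * t + 1 : ℝ) - ((j : ℝ) - i)) ≤
      ∑ j ∈ Finset.range (t + 2), ∑ i ∈ Finset.range j,
        (hammingDist (p (prefixWord k i)) (p (prefixWord k j)) : ℝ) := by
    refine Finset.sum_le_sum fun j hj => Finset.sum_le_sum fun i hi => ?_
    rw [Finset.mem_range] at hi hj
    have h := hp (prefixWord k i) (prefixWord k j) (by
      dsimp only
      rw [hammingNorm_prefixWord (by omega), hammingNorm_prefixWord (by omega)]
      exact hi.ne)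
    have hd := hammingDist_prefixWord_le (k := k) hi.le
    have h' : 2 * t + 1 + i ≤
        j + hammingDist (p (prefixWord k i)) (p (prefixWord k j)) := by omega
    have h'' : (2 * t + 1 + i : ℝ) ≤
        j + hammingDist (p (prefixWord k i)) (p (prefixWord k j)) := by exact_mod_cast h'
    linarith
  have h := hlower.trans (sum_hammingDist_le (fun i => p (prefixWord k i)) (t + 2))
  rw [sum_pairs_sub_dist] at h
  push_cast at h
  have ht : (0 : ℝ) ≤ t := Nat.cast_nonneg t
  have hr : 10 * (t : ℝ) * (t + 1) ≤ r * (3 * (t + 2)) := by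
    refine le_of_mul_le_mul_right ?_ (show (0 : ℝ) < t + 2 by linarith)
    nlinarith
  refine le_of_mul_le_mul_right ?_ (show (0 : ℝ) < 3 * (t + 2) by linarith)
  nlinarith

/-- Bounds on the redundancy of FCCs for the Hamming weight function: for `t ≥ 5` and
`k > t`, `10t/3 − 10/3 ≤ r_wt(k,t) ≤ 4t/(1 − 2√(ln(2t)/(2t)))`. -/
theorem fcc_hamming_weight_bounds {k t : ℕ} (ht : 5 ≤ t) (hk : t < k) :
    10 * (t : ℝ) / 3 - 10 / 3 ≤
        (FCCredundancy (fun u : Fin k → ZMod 2 => hammingNorm u) t : ℝ) ∧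
      (FCCredundancy (fun u : Fin k → ZMod 2 => hammingNorm u) t : ℝ) ≤
        4 * (t : ℝ) / (1 - 2 * Real.sqrt (Real.log (2 * (t : ℝ)) / (2 * (t : ℝ)))) := by
  obtain ⟨n, hn, c, hc⟩ := exists_code_length_le (D := 2 * t) (by omega)
  have hmem : n ∈ {r : ℕ | ∃ p : (Fin k → ZMod 2) → (Fin r → ZMod 2),
      IsFCC t (fun u : Fin k → ZMod 2 => hammingNorm u) p} :=
    ⟨_, isFCC_hammingNorm_of_code hc⟩
  obtain ⟨p, hp⟩ := Nat.sInf_mem ⟨n, hmem⟩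
  refine ⟨hp.le_redundancy hk, ?_⟩
  refine (Nat.cast_le.mpr (Nat.sInf_le hmem)).trans (hn.trans_eq ?_)
  push_cast
  ring
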